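/- Let δ be a positive integer, let d' and m' be integers with gcd(d', m') = 1, and let n be an integer. Then ∑_{t=1}^{δ} gcd(δ, t·d' + n·m') = ∑_{t=1}^{δ} gcd(δ, t·d' + n). -/

import Mathlib

/-- Some member of the progression `m + k * d`, with `d` and `m` coprime, is coprime to a given
nonzero modulus. -/
theorem exists_isCoprime_add_mul {δ : ℕ} (hδ : δ ≠ 0) {d m : ℤ} (h : IsCoprime d m) :
    ∃ k : ℤ, IsCoprime (δ : ℤ) (m + k * d) := by
  refine ⟨∏ p ∈ δ.primeFactors.filter (fun p : ℕ => ¬ (p : ℤ) ∣ m), (p : ℤ), ?_⟩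
  rw [Int.isCoprime_iff_gcd_eq_one]
  by_contra hne
  obtain ⟨p, hp, hpd⟩ := Nat.exists_prime_and_dvd hne
  have hpZ : Prime (p : ℤ) := Nat.prime_iff_prime_int.mp hp
  have hpδ : p ∣ δ :=
    Int.natCast_dvd_natCast.mp ((Int.natCast_dvd_natCast.mpr hpd).trans (Int.gcd_dvd_left ..))
  have hpu := (Int.natCast_dvd_natCast.mpr hpd).trans (Int.gcd_dvd_right ..)
  by_cases hpm : (p : ℤ) ∣ m
  · rcases hpZ.dvd_or_dvd ((dvd_add_right hpm).mp hpu) with hk | hd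
    · obtain ⟨q, hq, hpq⟩ := (hpZ.dvd_finsetProd_iff _).mp hk
      rw [Finset.mem_filter] at hq
      rw [Int.natCast_dvd_natCast,
        Nat.prime_dvd_prime_iff_eq hp (Nat.prime_of_mem_primeFactors hq.1)] at hpq
      exact hq.2 (hpq ▸ hpm)
    · exact hpZ.not_isUnit (h.isUnit_of_dvd' hd hpm)
  · refine hpm ((dvd_add_left (Dvd.dvd.mul_right ?_ d)).mp hpu)
    exact Finset.dvd_prod_of_mem (fun q : ℕ => (q : ℤ))
      (Finset.mem_filter.mpr ⟨Nat.mem_primeFactors.mpr ⟨hp, hpδ, hδ⟩, hpm⟩)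

theorem sum_Icc_natCast_zmod {M : Type*} [AddCommMonoid M] (δ : ℕ) [NeZero δ] (f : ZMod δ → M) :
    ∑ t ∈ Finset.Icc 1 δ, f (t : ZMod δ) = ∑ x, f x := by
  have hinj : Set.InjOn (fun t : ℕ => (t : ZMod δ)) (Finset.Icc 1 δ : Finset ℕ) := by
    intro a ha b hb hab
    rw [Finset.mem_coe, Finset.mem_Icc] at ha hb
    have hdvd := (ZMod.intCast_eq_intCast_iff_dvd_sub (a : ℤ) b δ).mp (by simpa using hab)
    have := Int.eq_zero_of_abs_lt_dvd hdvd (by rw [abs_lt]; omega)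
    omega
  have himage : (Finset.Icc 1 δ).image (fun t : ℕ => (t : ZMod δ)) = Finset.univ := by
    apply Finset.eq_univ_of_card
    rw [Finset.card_image_of_injOn hinj, Nat.card_Icc, ZMod.card, Nat.add_sub_cancel]
  rw [← himage, Finset.sum_image hinj]

theorem gcd_eq_gcd_val_intCast (δ : ℕ) [NeZero δ] (a : ℤ) :
    Int.gcd δ a = Nat.gcd δ (a : ZMod δ).val := by
  rw [← Int.gcd_natCast_natCast, ZMod.val_intCast, Int.gcd_comm _ (a % δ), Int.gcd_emod,
    Int.gcd_comm]

theorem gcd_val_mul_of_isCoprime (δ : ℕ) [NeZero δ] {u : ℤ} (hu : IsCoprime (δ : ℤ) u)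
    (x : ZMod δ) : Nat.gcd δ ((u : ZMod δ) * x).val = Nat.gcd δ x.val := by
  obtain ⟨a, rfl⟩ := ZMod.intCast_surjective x
  rw [← Int.cast_mul, ← gcd_eq_gcd_val_intCast, ← gcd_eq_gcd_val_intCast]
  exact Int.gcd_mul_right_right_of_gcd_eq_one (Int.isCoprime_iff_gcd_eq_one.mp hu)

theorem sum_gcd_twist_invariant (δ : ℕ) (hδ : 0 < δ) (d' m' : ℤ)
    (h : Int.gcd d' m' = 1) (n : ℤ) :
    ∑ t ∈ Finset.Icc 1 δ, Int.gcd (δ : ℤ) ((t : ℤ) * d' + n * m')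
      = ∑ t ∈ Finset.Icc 1 δ, Int.gcd (δ : ℤ) ((t : ℤ) * d' + n) := by
  have : NeZero δ := ⟨hδ.ne'⟩
  obtain ⟨k, hk⟩ := exists_isCoprime_add_mul hδ.ne' (Int.isCoprime_iff_gcd_eq_one.mpr h)
  obtain ⟨u, hu⟩ : IsUnit ((m' + k * d' : ℤ) : ZMod δ) := by
    simpa [isCoprime_zero_left] using hk.map (Int.castRingHom (ZMod δ))
  simp only [gcd_eq_gcd_val_intCast, Int.cast_add, Int.cast_mul, Int.cast_natCast]
  rw [sum_Icc_natCast_zmod δ fun x => Nat.gcd δ (x * d' + n * m' : ZMod δ).val,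
    sum_Icc_natCast_zmod δ fun x => Nat.gcd δ (x * d' + n : ZMod δ).val]
  symm
  -- An affine change of variable with unit slope multiplies the argument by that unit.
  refine Fintype.sum_equiv (u.mulLeft.trans (Equiv.addRight (n * k : ZMod δ))) _ _ fun x => ?_
  rw [← gcd_val_mul_of_isCoprime δ hk, Equiv.trans_apply, Units.mulLeft_apply,
    Equiv.coe_addRight, hu]
  push_cast
  ring_nf
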